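/- arXiv:math-ph/9904028 — 6 statements merged into one kernel-verified Lean document; each statement's English description precedes it below -/
import Mathlib

section
/- Let n be a natural number and ℋ : ℝ × (Fin n → ℝ) × (Fin n → ℝ) → ℝ smooth. Let u = (u⁰, uⁱ) and u' = (u'⁰, u'ⁱ) be projectable vector fields, i.e. u⁰, u'⁰ ∈ ℝ are constants and uⁱ, u'ⁱ : ℝ × (Fin n → ℝ) → ℝ are smooth. Define the symmetry currents J_u(t,q,p) = Σᵢ pᵢ uⁱ(t,q) − u⁰ ℋ(t,q,p) and similarly J_{u'}. Assume both u and u' are symmetries of ℋ, i.e. for all (t,q,p): −u⁰ ∂ℋ/∂t + Σᵢ pᵢ ∂uⁱ/∂t − Σᵢ uⁱ ∂ℋ/∂qᵢ + Σ_{i,j} (∂uⁱ/∂q_j) pᵢ ∂ℋ/∂p_j = 0, and likewise for u'. Then {J_u, J_{u'}}_V = J_{[u,u']}, where [u,u'] is the projectable vector field with time component 0 and components [u,u']ⁱ = u⁰ ∂u'ⁱ/∂t + Σ_j u^j ∂u'ⁱ/∂q_j − u'⁰ ∂uⁱ/∂t − Σ_j u'^j ∂uⁱ/∂q_j, so that J_{[u,u']}(t,q,p)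 = Σᵢ pᵢ [u,u']ⁱ(t,q). Hence the conserved currents form a Lie algebra under the Poisson bracket. -/
open scoped BigOperators

/-- The vertical Poisson bracket `{f,g}_V` on the momentum phase space
`V*Q ≅ ℝ × (Fin n → ℝ) × (Fin n → ℝ)` with coordinates `(t, q, p)`. -/
noncomputable def bracketV (n : ℕ) (f g : ℝ × (Fin n → ℝ) × (Fin n → ℝ) → ℝ)
    (z : ℝ × (Fin n → ℝ) × (Fin n → ℝ)) : ℝ :=
  ∑ i, (fderiv ℝ f z (0, 0, Pi.single i 1) * fderiv ℝ g z (0, Pi.single i 1, 0)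
      - fderiv ℝ g z (0, 0, Pi.single i 1) * fderiv ℝ f z (0, Pi.single i 1, 0))

/-- The symmetry current `J_u = Σᵢ pᵢ uⁱ(t,q) − u⁰ ℋ(t,q,p)` along the projectable
vector field `u = u⁰∂_t + Σᵢ uⁱ(t,q)∂_{qᵢ}` (with `u⁰` constant). -/
noncomputable def symCurrent (n : ℕ) (H : ℝ × (Fin n → ℝ) × (Fin n → ℝ) → ℝ)
    (u0 : ℝ) (u : Fin n → ℝ × (Fin n → ℝ) → ℝ)
    (z : ℝ × (Fin n → ℝ) × (Fin n → ℝ)) : ℝ :=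
  (∑ i, z.2.2 i * u i (z.1, z.2.1)) - u0 * H z

/-- The condition that `u` is a symmetry of the Hamiltonian form
`H = Σᵢ pᵢdqᵢ − ℋ dt`:
`−u⁰ ∂ℋ/∂t + Σᵢ pᵢ ∂uⁱ/∂t − Σᵢ uⁱ ∂ℋ/∂qᵢ + Σ_{i,j} (∂uⁱ/∂q_j) pᵢ ∂ℋ/∂p_j = 0`. -/
def IsSymmetryOf (n : ℕ) (H : ℝ × (Fin n → ℝ) × (Fin n → ℝ) → ℝ)
    (u0 : ℝ) (u : Fin n → ℝ × (Fin n → ℝ) → ℝ) : Prop :=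
  ∀ z : ℝ × (Fin n → ℝ) × (Fin n → ℝ),
    -u0 * fderiv ℝ H z (1, 0, 0)
      + (∑ i, z.2.2 i * fderiv ℝ (u i) (z.1, z.2.1) (1, 0))
      - (∑ i, u i (z.1, z.2.1) * fderiv ℝ H z (0, Pi.single i 1, 0))
      + (∑ i, ∑ j, fderiv ℝ (u i) (z.1, z.2.1) (0, Pi.single j 1) * z.2.2 i *
          fderiv ℝ H z (0, 0, Pi.single j 1)) = 0

/-- The derivative of a symmetry current, evaluated on an arbitrary tangent vector. -/
theorem fderiv_symCurrent_apply {n : ℕ} {H : ℝ × (Fin n → ℝ) × (Fin n → ℝ) → ℝ}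
    {u0 : ℝ} {u : Fin n → ℝ × (Fin n → ℝ) → ℝ} {z : ℝ × (Fin n → ℝ) × (Fin n → ℝ)}
    (hH : DifferentiableAt ℝ H z) (hu : ∀ i, DifferentiableAt ℝ (u i) (z.1, z.2.1))
    (v : ℝ × (Fin n → ℝ) × (Fin n → ℝ)) :
    fderiv ℝ (symCurrent n H u0 u) z v =
      (∑ i, (z.2.2 i * fderiv ℝ (u i) (z.1, z.2.1) (v.1, v.2.1)
        + u i (z.1, z.2.1) * v.2.2 i)) - u0 * fderiv ℝ H z v := by
  have hb : HasFDerivAt (fun z : ℝ × (Fin n → ℝ) × (Fin n → ℝ) => (z.1, z.2.1))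
      ((ContinuousLinearMap.fst ℝ ℝ ((Fin n → ℝ) × (Fin n → ℝ))).prod
        ((ContinuousLinearMap.fst ℝ (Fin n → ℝ) (Fin n → ℝ)).comp
          (ContinuousLinearMap.snd ℝ ℝ ((Fin n → ℝ) × (Fin n → ℝ))))) z :=
    hasFDerivAt_fst.prodMk (hasFDerivAt_fst.comp z hasFDerivAt_snd)
  let momentum (i : Fin n) : ℝ × (Fin n → ℝ) × (Fin n → ℝ) →L[ℝ] ℝ :=
    (ContinuousLinearMap.proj i).comp
      ((ContinuousLinearMap.snd ℝ (Fin n → ℝ) (Fin n → ℝ)).comp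
        (ContinuousLinearMap.snd ℝ ℝ ((Fin n → ℝ) × (Fin n → ℝ))))
  have hJ : HasFDerivAt (symCurrent n H u0 u) _ z :=
    (HasFDerivAt.fun_sum fun i _ => (momentum i).hasFDerivAt.mul
      ((hu i).hasFDerivAt.comp z hb)).sub (hH.hasFDerivAt.const_mul u0)
  rw [hJ.fderiv]
  simp [momentum]

/-- The momentum derivative of a symmetry current: `∂J_u/∂pᵢ = uⁱ − u⁰ ∂ℋ/∂pᵢ`. -/
theorem fderiv_symCurrent_momentum {n : ℕ} {H : ℝ × (Fin n → ℝ) × (Fin n → ℝ) → ℝ}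
    {u0 : ℝ} {u : Fin n → ℝ × (Fin n → ℝ) → ℝ} {z : ℝ × (Fin n → ℝ) × (Fin n → ℝ)}
    (hH : DifferentiableAt ℝ H z) (hu : ∀ i, DifferentiableAt ℝ (u i) (z.1, z.2.1))
    (i : Fin n) :
    fderiv ℝ (symCurrent n H u0 u) z (0, 0, Pi.single i 1) =
      u i (z.1, z.2.1) - u0 * fderiv ℝ H z (0, 0, Pi.single i 1) := by
  have h0 : ((0 : ℝ), (0 : Fin n → ℝ)) = 0 := rfl
  rw [fderiv_symCurrent_apply hH hu]
  simp [h0, Pi.single_apply]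

/-- The position derivative of a symmetry current:
`∂J_u/∂qᵢ = Σₖ pₖ ∂uᵏ/∂qᵢ − u⁰ ∂ℋ/∂qᵢ`. -/
theorem fderiv_symCurrent_position {n : ℕ} {H : ℝ × (Fin n → ℝ) × (Fin n → ℝ) → ℝ}
    {u0 : ℝ} {u : Fin n → ℝ × (Fin n → ℝ) → ℝ} {z : ℝ × (Fin n → ℝ) × (Fin n → ℝ)}
    (hH : DifferentiableAt ℝ H z) (hu : ∀ i, DifferentiableAt ℝ (u i) (z.1, z.2.1))
    (i : Fin n) :
    fderiv ℝ (symCurrent n H u0 u) z (0, Pi.single i 1, 0) =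
      (∑ k, z.2.2 k * fderiv ℝ (u k) (z.1, z.2.1) (0, Pi.single i 1))
        - u0 * fderiv ℝ H z (0, Pi.single i 1, 0) := by
  rw [fderiv_symCurrent_apply hH hu]
  simp

/-- Conserved symmetry currents form a Lie algebra:
`{J_u, J_{u'}}_V = J_{[u,u']}`, where `[u,u']` has time component `0` and
`[u,u']ⁱ = u⁰∂_t u'ⁱ + Σ_j u^j ∂_{q_j}u'ⁱ − u'⁰∂_t uⁱ − Σ_j u'^j ∂_{q_j}uⁱ`. -/
theorem bracket_symCurrent (n : ℕ) (H : ℝ × (Fin n → ℝ) × (Fin n → ℝ) → ℝ)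
    (hH : ContDiff ℝ (⊤ : ℕ∞) H)
    (u0 u'0 : ℝ) (u u' : Fin n → ℝ × (Fin n → ℝ) → ℝ)
    (hu : ∀ i, ContDiff ℝ (⊤ : ℕ∞) (u i)) (hu' : ∀ i, ContDiff ℝ (⊤ : ℕ∞) (u' i))
    (hsym : IsSymmetryOf n H u0 u) (hsym' : IsSymmetryOf n H u'0 u') :
    ∀ z : ℝ × (Fin n → ℝ) × (Fin n → ℝ),
      bracketV n (symCurrent n H u0 u) (symCurrent n H u'0 u') z =
        symCurrent n H 0
          (fun i y => u0 * fderiv ℝ (u' i) y (1, 0)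
            + (∑ j, u j y * fderiv ℝ (u' i) y (0, Pi.single j 1))
            - u'0 * fderiv ℝ (u i) y (1, 0)
            - (∑ j, u' j y * fderiv ℝ (u i) y (0, Pi.single j 1))) z := by
  intro z
  have hHz : DifferentiableAt ℝ H z := hH.differentiable (by simp) z
  have huz : ∀ i, DifferentiableAt ℝ (u i) (z.1, z.2.1) :=
    fun i => (hu i).differentiable (by simp) _
  have huz' : ∀ i, DifferentiableAt ℝ (u' i) (z.1, z.2.1) :=
    fun i => (hu' i).differentiable (by simp) _
  have swap : ∀ (w : Fin n → ℝ × (Fin n → ℝ) → ℝ) (c : Fin n → ℝ),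
      (∑ i, z.2.2 i * ∑ j, c j * fderiv ℝ (w i) (z.1, z.2.1) (0, Pi.single j 1)) =
        ∑ j, c j * ∑ i, z.2.2 i * fderiv ℝ (w i) (z.1, z.2.1) (0, Pi.single j 1) := by
    intro w c
    simp only [Finset.mul_sum]
    rw [Finset.sum_comm]
    exact Finset.sum_congr rfl fun _ _ => Finset.sum_congr rfl fun _ _ => by ring
  have assoc : ∀ w : Fin n → ℝ × (Fin n → ℝ) → ℝ,
      (∑ i, ∑ j, fderiv ℝ (w i) (z.1, z.2.1) (0, Pi.single j 1) * z.2.2 i *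
          fderiv ℝ H z (0, 0, Pi.single j 1)) =
        ∑ j, fderiv ℝ H z (0, 0, Pi.single j 1) *
          ∑ i, z.2.2 i * fderiv ℝ (w i) (z.1, z.2.1) (0, Pi.single j 1) := by
    intro w
    rw [← swap, Finset.sum_congr rfl]
    intro i _
    rw [Finset.mul_sum]
    exact Finset.sum_congr rfl fun _ _ => by ring
  have h := hsym z
  have h' := hsym' z
  rw [assoc] at h h'
  simp only [bracketV, fderiv_symCurrent_momentum hHz huz, fderiv_symCurrent_momentum hHz huz',
    fderiv_symCurrent_position hHz huz, fderiv_symCurrent_position hHz huz']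
  have expand : ∀ a a' b c P P' : Fin n → ℝ,
      (∑ i, ((a i - u0 * b i) * (P' i - u'0 * c i) - (a' i - u'0 * b i) * (P i - u0 * c i))) =
        (∑ i, a i * P' i) - (∑ i, a' i * P i) - u'0 * ((∑ i, a i * c i) - ∑ i, b i * P i)
          + u0 * ((∑ i, a' i * c i) - ∑ i, b i * P' i) := by
    intro a a' b c P P'
    simp only [Finset.mul_sum, ← Finset.sum_add_distrib, ← Finset.sum_sub_distrib]
    exact Finset.sum_congr rfl fun _ _ => by ring
  rw [expand]
  simp only [symCurrent, mul_add, mul_sub, Finset.sum_add_distrib, Finset.sum_sub_distrib, swap]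
  simp only [mul_left_comm _ u0, mul_left_comm _ u'0, ← Finset.mul_sum]
  linear_combination u'0 * h - u0 * h'
end

section
/- Let n be a natural number and ℋ : ℝ × (Fin n → ℝ) × (Fin n → ℝ) → ℝ smooth. Let u = (u⁰, uⁱ) be a projectable vector field (u⁰ ∈ ℝ constant, uⁱ : ℝ × (Fin n → ℝ) → ℝ smooth) which is a symmetry of ℋ: for all (t,q,p), −u⁰ ∂ℋ/∂t + Σᵢ pᵢ ∂uⁱ/∂t − Σᵢ uⁱ ∂ℋ/∂qᵢ + Σ_{i,j} (∂uⁱ/∂q_j) pᵢ ∂ℋ/∂p_j = 0. Then for every differentiable solution (c, p) : ℝ → (Fin n → ℝ) × (Fin n → ℝ) of the Hamilton equations c'ᵢ(t) = ∂ℋ/∂pᵢ(t, c(t), p(t)) and p'ᵢ(t) = −∂ℋ/∂qᵢ(t, c(t), p(t)), the function t ↦ J_u(t, c(t), p(t)) = Σᵢ pᵢ(t) uⁱ(t, c(t)) − u⁰ ℋ(t, c(t), p(t)) is constant. -/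
open scoped BigOperators

/-- A linear functional precomposed with a linear map out of `Fin n → ℝ` is determined by the
images of the standard basis vectors. -/
lemma ContinuousLinearMap.apply_eq_sum_single {n : ℕ} {E : Type*} [NormedAddCommGroup E]
    [NormedSpace ℝ E] (L : E →L[ℝ] ℝ) (f : (Fin n → ℝ) →ₗ[ℝ] E) (v : Fin n → ℝ) :
    L (f v) = ∑ j, v j * L (f (Pi.single j 1)) := by
  have h : ∀ j : Fin n, (Pi.single j 1 : Fin n → ℝ) = fun k => if j = k then 1 else 0 := fun j => by
    ext k
    simp [Pi.single_apply, eq_comm]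
  simpa [h] using (L.toLinearMap ∘ₗ f).pi_apply_eq_sum_univ v

/-- The derivative of a time-dependent function on configuration space along a curve. -/
lemma HasDerivAt.comp_configuration {n : ℕ} {f : ℝ × (Fin n → ℝ) → ℝ} {c : ℝ → Fin n → ℝ}
    {c' : Fin n → ℝ} {t : ℝ} (hf : DifferentiableAt ℝ f (t, c t)) (hc : HasDerivAt c c' t) :
    HasDerivAt (fun s => f (s, c s))
      (fderiv ℝ f (t, c t) (1, 0) + ∑ j, c' j * fderiv ℝ f (t, c t) (0, Pi.single j 1)) t := by
  have h := hf.hasFDerivAt.comp_hasDerivAt t ((hasDerivAt_id t).prodMk hc)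
  have hq := (fderiv ℝ f (t, c t)).apply_eq_sum_single (LinearMap.inr ℝ ℝ (Fin n → ℝ)) c'
  simp only [LinearMap.inr_apply] at hq
  rw [← hq, ← map_add]
  simpa [Function.comp_def] using h

/-- Along a solution of the Hamilton equations, the total derivative of the Hamiltonian is its
partial derivative in time. -/
lemma hasDerivAt_hamiltonian {n : ℕ} {H : ℝ × (Fin n → ℝ) × (Fin n → ℝ) → ℝ}
    {c p : ℝ → Fin n → ℝ} {t : ℝ} (hH : DifferentiableAt ℝ H (t, c t, p t))
    (hc : HasDerivAt c (fun i => fderiv ℝ H (t, c t, p t) (0, 0, Pi.single i 1)) t)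
    (hp : HasDerivAt p (fun i => -(fderiv ℝ H (t, c t, p t) (0, Pi.single i 1, 0))) t) :
    HasDerivAt (fun s => H (s, c s, p s)) (fderiv ℝ H (t, c t, p t) (1, 0, 0)) t := by
  have h := hH.hasFDerivAt.comp_hasDerivAt t ((hasDerivAt_id t).prodMk (hc.prodMk hp))
  refine h.congr_deriv ?_
  set L := fderiv ℝ H (t, c t, p t)
  set a : Fin n → ℝ := fun i => L (0, 0, Pi.single i 1) with ha
  set b : Fin n → ℝ := fun i => -(L (0, Pi.single i 1, 0)) with hb
  have hq := L.apply_eq_sum_single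
    (LinearMap.inr ℝ ℝ ((Fin n → ℝ) × (Fin n → ℝ)) ∘ₗ LinearMap.inl ℝ (Fin n → ℝ) (Fin n → ℝ)) a
  have hr := L.apply_eq_sum_single
    (LinearMap.inr ℝ ℝ ((Fin n → ℝ) × (Fin n → ℝ)) ∘ₗ LinearMap.inr ℝ (Fin n → ℝ) (Fin n → ℝ)) b
  simp only [LinearMap.comp_apply, LinearMap.inr_apply, LinearMap.inl_apply] at hq hr
  have hsplit : ((1, a, b) : ℝ × (Fin n → ℝ) × (Fin n → ℝ))
      = (1, 0, 0) + (0, a, 0) + (0, 0, b) := by simp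
  have hcancel : L (0, a, 0) + L (0, 0, b) = 0 := by
    rw [hq, hr, ← Finset.sum_add_distrib]
    exact Finset.sum_eq_zero fun i _ => by simp only [ha, hb]; ring
  rw [hsplit, map_add, map_add, add_assoc, hcancel, add_zero]

/-- Along any solution of the Hamilton equations `c'ᵢ = ∂ℋ/∂pᵢ`, `p'ᵢ = −∂ℋ/∂qᵢ`,
the symmetry current `J_u = Σᵢ pᵢuⁱ(t,c) − u⁰ℋ(t,c,p)` of a symmetry `u` of `ℋ`
is constant in time. -/
theorem symCurrent_conserved (n : ℕ) (H : ℝ × (Fin n → ℝ) × (Fin n → ℝ) → ℝ)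
    (hH : ContDiff ℝ (⊤ : ℕ∞) H)
    (u0 : ℝ) (u : Fin n → ℝ × (Fin n → ℝ) → ℝ)
    (hu : ∀ i, ContDiff ℝ (⊤ : ℕ∞) (u i))
    (hsym : IsSymmetryOf n H u0 u)
    (c p : ℝ → Fin n → ℝ)
    (hc : ∀ t i, HasDerivAt (fun s => c s i)
      (fderiv ℝ H (t, c t, p t) (0, 0, Pi.single i 1)) t)
    (hp : ∀ t i, HasDerivAt (fun s => p s i)
      (-(fderiv ℝ H (t, c t, p t) (0, Pi.single i 1, 0))) t) :
    ∀ t t' : ℝ,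
      (∑ i, p t i * u i (t, c t)) - u0 * H (t, c t, p t)
        = (∑ i, p t' i * u i (t', c t')) - u0 * H (t', c t', p t') := by
  have hderiv : ∀ t, HasDerivAt (fun s => (∑ i, p s i * u i (s, c s)) - u0 * H (s, c s, p s))
      0 t := by
    intro t
    have hct := hasDerivAt_pi.2 (hc t)
    have hpt := hasDerivAt_pi.2 (hp t)
    have hHt := hasDerivAt_hamiltonian (hH.differentiable (by simp) _) hct hpt
    have hut := fun i => HasDerivAt.comp_configuration ((hu i).differentiable (by simp) _) hct
    refine ((HasDerivAt.fun_sum fun i _ => (hp t i).mul (hut i)).sub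
      (hHt.const_mul u0)).congr_deriv ?_
    refine Eq.trans ?_ (hsym (t, c t, p t))
    simp only [mul_add, Finset.mul_sum, Finset.sum_add_distrib, neg_mul, Finset.sum_neg_distrib]
    have hcomm : ∀ i j, p t i * (fderiv ℝ H (t, c t, p t) (0, 0, Pi.single j 1) *
          fderiv ℝ (u i) (t, c t) (0, Pi.single j 1))
        = fderiv ℝ (u i) (t, c t) (0, Pi.single j 1) * p t i *
          fderiv ℝ H (t, c t, p t) (0, 0, Pi.single j 1) := fun i j => by ring
    simp only [hcomm, mul_comm (fderiv ℝ H (t, c t, p t) (0, Pi.single _ 1, 0))]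
    ring
  exact is_const_of_deriv_eq_zero (fun t => (hderiv t).differentiableAt)
    fun t => (hderiv t).deriv
end

section
/- Let A be a commutative ring carrying a Lie ring bracket ⁅·,·⁆ satisfying the Leibniz rule ⁅a, b·c⁆ = ⁅a,b⁆·c + b·⁅a,c⁆ for all a,b,c ∈ A (a Poisson algebra), let I be an ideal of A, and let Ī = {f ∈ A : ∀ g ∈ I, ⁅f,g⁆ ∈ I} be its normalizer. Then: (1) I' := Ī ∩ I is closed under addition, multiplication and the bracket (a Poisson subalgebra of Ī); and (2) the product of any two elements of I lies in I', i.e. I·I ⊆ I'; in particular products of second-class constraints are first-class constraints. -/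
/-- In a Poisson algebra, with `Ī` the normalizer of an ideal `I`:
(1) `I' = Ī ∩ I` is closed under addition, multiplication and the bracket;
(2) products of any two elements of `I` lie in `I'` (products of second-class
constraints are first-class constraints). -/
theorem first_class_constraints {A : Type*} [CommRing A]
    (br : A → A → A)
    (hadd_left : ∀ a b c : A, br (a + b) c = br a c + br b c)
    (hadd_right : ∀ a b c : A, br a (b + c) = br a b + br a c)
    (halt : ∀ a : A, br a a = 0)
    (hjac : ∀ a b c : A, br a (br b c) = br (br a b) c + br b (br a c))
    (hleib : ∀ a b c : A, br a (b * c) = br a b * c + b * br a c)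
    (I : Ideal A) :
    ((∀ f ∈ {f : A | ∀ g ∈ I, br f g ∈ I} ∩ I, ∀ f' ∈ {f : A | ∀ g ∈ I, br f g ∈ I} ∩ I,
        f + f' ∈ {f : A | ∀ g ∈ I, br f g ∈ I} ∩ I) ∧
     (∀ f ∈ {f : A | ∀ g ∈ I, br f g ∈ I} ∩ I, ∀ f' ∈ {f : A | ∀ g ∈ I, br f g ∈ I} ∩ I,
        f * f' ∈ {f : A | ∀ g ∈ I, br f g ∈ I} ∩ I) ∧
     (∀ f ∈ {f : A | ∀ g ∈ I, br f g ∈ I} ∩ I, ∀ f' ∈ {f : A | ∀ g ∈ I, br f g ∈ I} ∩ I,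
        br f f' ∈ {f : A | ∀ g ∈ I, br f g ∈ I} ∩ I)) ∧
    (∀ a ∈ I, ∀ b ∈ I, a * b ∈ {f : A | ∀ g ∈ I, br f g ∈ I} ∩ I) := by
  have skew (a b : A) : br a b = -br b a := by
    have h := halt (a + b)
    rw [hadd_left, hadd_right, hadd_right, halt, halt, zero_add, add_zero] at h
    exact eq_neg_of_add_eq_zero_left h
  have mul_mem : ∀ a ∈ I, ∀ b ∈ I, a * b ∈ {f : A | ∀ g ∈ I, br f g ∈ I} ∩ I := by
    refine fun a ha b hb => ⟨fun g _ => ?_, I.mul_mem_left a hb⟩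
    rw [skew, hleib]
    exact I.neg_mem (I.add_mem (I.mul_mem_left _ hb) (I.mul_mem_right _ ha))
  refine ⟨⟨?_, fun f hf f' hf' => mul_mem f hf.2 f' hf'.2, ?_⟩, mul_mem⟩
  · rintro f ⟨hf, hfI⟩ f' ⟨hf', hfI'⟩
    refine ⟨fun g hg => ?_, I.add_mem hfI hfI'⟩
    rw [hadd_left]
    exact I.add_mem (hf g hg) (hf' g hg)
  · rintro f ⟨hf, hfI⟩ f' ⟨hf', hfI'⟩
    refine ⟨fun g hg => ?_, hf f' hfI'⟩
    rw [eq_sub_of_add_eq (hjac f f' g).symm]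
    exact I.sub_mem (hf _ (hf' g hg)) (hf' _ (hf g hg))
end

section
/- Let n be a natural number, and let L, ℋ : ℝ × (Fin n → ℝ) × (Fin n → ℝ) → ℝ be smooth, where ℋ is weakly associated with L in the following coordinate sense: (i) for all (t,q,v), ∇_v L(t, q, ∇_pℋ(t, q, ∇_vL(t,q,v))) = ∇_vL(t,q,v); (ii) for every point (t,q,p) of the Lagrangian constraint space, i.e. with p = ∇_vL(t,q,w) for some w, one has ℋ(t,q,p) = Σᵢ pᵢ ∂ℋ/∂pᵢ(t,q,p) − L(t, q, ∇_pℋ(t,q,p)). Let (c, p) : ℝ → (Fin n → ℝ) × (Fin n → ℝ) be a differentiable solution of the Hamilton equations c'ᵢ(t) = ∂ℋ/∂pᵢ(t, c(t), p(t)), p'ᵢ(t) = −∂ℋ/∂qᵢ(t, c(t), p(t)), which lives in the Lagrangian constraint space: for every t there exists w(t) with p(t) = ∇_vL(t, c(t), w(t)). Then c satisfies the Lagrange equations for L: d/dt[∂L/∂vᵢ(t, c(t), c'(t))] = ∂L/∂qᵢ(t, c(t), c'(t)) for all t. -/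
open scoped BigOperators

/-- Partial derivative `∂F/∂qᵢ` on `ℝ × (Fin n → ℝ) × (Fin n → ℝ)`. -/
noncomputable def pQ (n : ℕ) (F : ℝ × (Fin n → ℝ) × (Fin n → ℝ) → ℝ) (i : Fin n)
    (z : ℝ × (Fin n → ℝ) × (Fin n → ℝ)) : ℝ :=
  fderiv ℝ F z (0, Pi.single i 1, 0)

/-- Partial derivative `∂F/∂vᵢ` (resp. `∂F/∂pᵢ`) in the third slot of
`ℝ × (Fin n → ℝ) × (Fin n → ℝ)`. -/
noncomputable def pV (n : ℕ) (F : ℝ × (Fin n → ℝ) × (Fin n → ℝ) → ℝ) (i : Fin n)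
    (z : ℝ × (Fin n → ℝ) × (Fin n → ℝ)) : ℝ :=
  fderiv ℝ F z (0, 0, Pi.single i 1)

theorem fderiv_apply_single_add (n : ℕ) (F : ℝ × (Fin n → ℝ) × (Fin n → ℝ) → ℝ) (i : Fin n)
    (z : ℝ × (Fin n → ℝ) × (Fin n → ℝ)) (u : Fin n → ℝ) :
    fderiv ℝ F z (0, Pi.single i 1, u) = pQ n F i z + ∑ j, u j * pV n F j z := by
  have hu : ((0, 0, u) : ℝ × (Fin n → ℝ) × (Fin n → ℝ))
      = ∑ j, u j • ((0, 0, Pi.single j 1) : ℝ × (Fin n → ℝ) × (Fin n → ℝ)) := by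
    refine Prod.ext ?_ (Prod.ext ?_ ?_)
    · simp [Prod.fst_sum]
    · simp [Prod.fst_sum, Prod.snd_sum]
    · simpa [Prod.snd_sum] using pi_eq_sum_univ' u
  have hsplit : ((0, Pi.single i 1, u) : ℝ × (Fin n → ℝ) × (Fin n → ℝ))
      = (0, Pi.single i 1, 0) + (0, 0, u) := by simp
  rw [hsplit, map_add, hu, map_sum]
  simp only [map_smul, smul_eq_mul, pQ, pV]

theorem differentiable_pV (n : ℕ) {F : ℝ × (Fin n → ℝ) × (Fin n → ℝ) → ℝ}
    (hF : ContDiff ℝ (⊤ : ℕ∞) F) (i : Fin n) : Differentiable ℝ (pV n F i) := by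
  have h : Differentiable ℝ (fderiv ℝ F) :=
    (hF.fderiv_right (m := (⊤ : ℕ∞)) le_rfl).differentiable (by simp)
  exact h.clm_apply (differentiable_const _)

/-- Derivative of `F` along a curve that moves in the `i`-th position direction at unit speed. -/
theorem hasDerivAt_comp_position_line (n : ℕ) {F : ℝ × (Fin n → ℝ) × (Fin n → ℝ) → ℝ}
    (hF : Differentiable ℝ F) (t : ℝ) (q : Fin n → ℝ) (i : Fin n)
    {u : ℝ → Fin n → ℝ} {u' : Fin n → ℝ} (hu : HasDerivAt u u' 0) :
    HasDerivAt (fun ε : ℝ => F (t, q + ε • Pi.single i 1, u ε))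
      (pQ n F i (t, q, u 0) + ∑ j, u' j * pV n F j (t, q, u 0)) 0 := by
  have hq : HasDerivAt (fun ε : ℝ => q + ε • (Pi.single i 1 : Fin n → ℝ)) (Pi.single i 1) 0 := by
    simpa using ((hasDerivAt_id (0 : ℝ)).smul_const (Pi.single i 1 : Fin n → ℝ)).const_add q
  have hz := (hasDerivAt_const (0 : ℝ) t).prodMk (hq.prodMk hu)
  have h := (hF _).hasFDerivAt.comp_hasDerivAt (0 : ℝ) hz
  rw [fderiv_apply_single_add] at h
  simpa [Function.comp_def] using h

/-- On the Lagrangian constraint space, a weakly associated Hamiltonian satisfies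
`∂H/∂qᵢ = -∂L/∂qᵢ`. -/
theorem pQ_eq_neg_of_weaklyAssociated (n : ℕ)
    {L H : ℝ × (Fin n → ℝ) × (Fin n → ℝ) → ℝ}
    (hL : ContDiff ℝ (⊤ : ℕ∞) L) (hH : ContDiff ℝ (⊤ : ℕ∞) H)
    (hweak : ∀ (t : ℝ) (q p : Fin n → ℝ),
      (∃ w : Fin n → ℝ, p = fun i => pV n L i (t, q, w)) →
      H (t, q, p) = (∑ i, p i * pV n H i (t, q, p))
        - L (t, q, fun j => pV n H j (t, q, p)))
    (t : ℝ) (q p : Fin n → ℝ)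
    (hp : p = fun i => pV n L i (t, q, fun j => pV n H j (t, q, p))) (i : Fin n) :
    pQ n H i (t, q, p) = -pQ n L i (t, q, fun j => pV n H j (t, q, p)) := by
  set w : Fin n → ℝ := fun j => pV n H j (t, q, p) with hw
  let P : ℝ → Fin n → ℝ := fun ε j => pV n L j (t, q + ε • Pi.single i 1, w)
  let V : ℝ → Fin n → ℝ := fun ε j => pV n H j (t, q + ε • Pi.single i 1, P ε)
  have hP : DifferentiableAt ℝ P 0 := differentiableAt_pi.2 fun j =>
    (hasDerivAt_comp_position_line n (differentiable_pV n hL j) t q i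
      (hasDerivAt_const (0 : ℝ) w)).differentiableAt
  have hV : DifferentiableAt ℝ V 0 := differentiableAt_pi.2 fun j =>
    (hasDerivAt_comp_position_line n (differentiable_pV n hH j) t q i
      hP.hasDerivAt).differentiableAt
  have hP0 : P 0 = p := by simpa [P] using hp.symm
  have hV0 : V 0 = w := by simp [V, hP0, hw]
  have hHd := hasDerivAt_comp_position_line n (hH.differentiable (by simp)) t q i hP.hasDerivAt
  have hLd := hasDerivAt_comp_position_line n (hL.differentiable (by simp)) t q i hV.hasDerivAt
  have hPV : HasDerivAt (fun ε => ∑ j, P ε j * V ε j)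
      (∑ j, (deriv P 0 j * V 0 j + P 0 j * deriv V 0 j)) 0 :=
    HasDerivAt.fun_sum fun j _ =>
      (hasDerivAt_pi.1 hP.hasDerivAt j).mul (hasDerivAt_pi.1 hV.hasDerivAt j)
  have hlegendre : (fun ε : ℝ => H (t, q + ε • Pi.single i 1, P ε))
      = fun ε => (∑ j, P ε j * V ε j) - L (t, q + ε • Pi.single i 1, V ε) :=
    funext fun ε => hweak t _ (P ε) ⟨w, rfl⟩
  rw [hlegendre] at hHd
  have heq := hHd.unique (hPV.sub hLd)
  rw [hP0, hV0, Finset.sum_add_distrib] at heq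
  have hLp : ∑ j, deriv V 0 j * pV n L j (t, q, w) = ∑ j, p j * deriv V 0 j :=
    Finset.sum_congr rfl fun j _ => by rw [← congrFun hp j, mul_comm]
  have hHw : ∑ j, deriv P 0 j * pV n H j (t, q, p) = ∑ j, deriv P 0 j * w j := rfl
  linarith

/-- If `ℋ` is weakly associated with `L` and `(c,p)` is a solution of the
Hamilton equations for `ℋ` living in the Lagrangian constraint space, then
`c` satisfies the Lagrange equations for `L` (with `c' = ∇_pℋ(t,c,p)`). -/
theorem hamilton_solution_in_constraint_is_lagrange (n : ℕ)
    (L H : ℝ × (Fin n → ℝ) × (Fin n → ℝ) → ℝ)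
    (hL : ContDiff ℝ (⊤ : ℕ∞) L) (hH : ContDiff ℝ (⊤ : ℕ∞) H)
    (hassoc : ∀ (t : ℝ) (q v : Fin n → ℝ),
      (fun i => pV n L i (t, q, fun j => pV n H j (t, q, fun k => pV n L k (t, q, v))))
        = fun i => pV n L i (t, q, v))
    (hweak : ∀ (t : ℝ) (q p : Fin n → ℝ),
      (∃ w : Fin n → ℝ, p = fun i => pV n L i (t, q, w)) →
      H (t, q, p) = (∑ i, p i * pV n H i (t, q, p))
        - L (t, q, fun j => pV n H j (t, q, p)))
    (c p : ℝ → Fin n → ℝ)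
    (hc : ∀ t i, HasDerivAt (fun s => c s i) (pV n H i (t, c t, p t)) t)
    (hp : ∀ t i, HasDerivAt (fun s => p s i) (-(pQ n H i (t, c t, p t))) t)
    (hlives : ∀ t : ℝ, ∃ w : Fin n → ℝ, p t = fun i => pV n L i (t, c t, w)) :
    ∀ t i, HasDerivAt
      (fun s => pV n L i (s, c s, fun j => pV n H j (s, c s, p s)))
      (pQ n L i (t, c t, fun j => pV n H j (t, c t, p t))) t := by
  have hconstraint : ∀ s, p s = fun i => pV n L i (s, c s, fun j => pV n H j (s, c s, p s)) := by
    intro s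
    obtain ⟨w, hw⟩ := hlives s
    have h := hassoc s (c s) w
    rw [← hw] at h
    exact h.symm
  intro t i
  have h := hp t i
  rw [pQ_eq_neg_of_weaklyAssociated n hL hH hweak t (c t) (p t) (hconstraint t) i, neg_neg] at h
  exact h.congr_of_eventuallyEq (.of_forall fun s => (congrFun (hconstraint s) i).symm)
end

section
/- Let n be a natural number, and let L, ℋ : ℝ × (Fin n → ℝ) × (Fin n → ℝ) → ℝ be smooth, where ℋ is weakly associated with L: (i) for all (t,q,v), ∇_vL(t, q, ∇_pℋ(t, q, ∇_vL(t,q,v))) = ∇_vL(t,q,v); (ii) for every (t,q,p) with p = ∇_vL(t,q,w) for some w, ℋ(t,q,p) = Σᵢ pᵢ ∂ℋ/∂pᵢ(t,q,p) − L(t,q,∇_pℋ(t,q,p)). Let (c, v) : ℝ → (Fin n → ℝ) × (Fin n → ℝ) be a differentiable solution of the Cartan equations: for all t and all i, (1) Σ_j ∂²L/∂vᵢ∂v_j(t,c(t),v(t)) · (c'_j(t) − v_j(t)) = 0 and (2) ∂L/∂qᵢ(t,c(t),v(t)) − d/dt[∂L/∂vᵢ(t,c(t),v(t))] + Σ_j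 (c'_j(t) − v_j(t)) · ∂²L/∂qᵢ∂v_j(t,c(t),v(t)) = 0. Assume moreover the compatibility condition ∇_pℋ(t, c(t), ∇_vL(t,c(t),v(t))) = c'(t) for all t. Then the curve r(t) = (c(t), p(t)) with p(t) = ∇_vL(t, c(t), v(t)) is a solution of the Hamilton equations c'ᵢ(t) = ∂ℋ/∂pᵢ(t,c(t),p(t)) and p'ᵢ(t) = −∂ℋ/∂qᵢ(t,c(t),p(t)). -/
open scoped BigOperators

open scoped Matrix ContDiff Topology

/-- If `DP = DP ∘ Q(P)`, then `P` is constant in the directions killed by `Q (P w)`. -/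
theorem map_add_eq_of_fderiv_eq_comp {E F : Type*} [NormedAddCommGroup E] [NormedSpace ℝ E]
    [NormedAddCommGroup F] [NormedSpace ℝ F] {P : E → F} (hP : ContDiff ℝ ∞ P)
    {Q : F → E →L[ℝ] E} (hQ : ContDiff ℝ ∞ Q)
    (hPQ : ∀ w, fderiv ℝ P w = (fderiv ℝ P w).comp (Q (P w)))
    {w e : E} (he : Q (P w) e = 0) : P (w + e) = P w := by
  have hPd : Differentiable ℝ P := hP.differentiable (by simp)
  have hline : ∀ s : ℝ, HasDerivAt (fun s : ℝ => w + s • e) e s := fun s => by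
    simpa using ((hasDerivAt_id s).smul_const e).const_add w
  have hg : ∀ s : ℝ, HasDerivAt (fun s : ℝ => P (w + s • e) - P w)
      (fderiv ℝ P (w + s • e) e) s := fun s =>
    ((hPd _).hasFDerivAt.comp_hasDerivAt s (hline s)).sub_const _
  have hgc : Continuous fun s : ℝ => P (w + s • e) := hPd.continuous.comp (by fun_prop)
  have hlip : LocallyLipschitz fun p => Q p e :=
    ((hQ.clm_apply contDiff_const).of_le (by simp)).locallyLipschitz
  obtain ⟨K, hK⟩ := (hlip.locallyLipschitzOn (s := (fun s : ℝ => P (w + s • e)) ''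
    Set.Icc 0 1)).exists_lipschitzOnWith_of_compact (isCompact_Icc.image hgc)
  have hAc : Continuous fun s : ℝ => fderiv ℝ P (w + s • e) :=
    (hP.continuous_fderiv (by simp)).comp (by fun_prop)
  obtain ⟨C, hC⟩ := (isCompact_Icc (a := (0 : ℝ)) (b := 1)).exists_bound_of_continuousOn
    hAc.continuousOn
  have hzero := eq_zero_of_abs_deriv_le_mul_abs_self_of_eq_zero_right
    (f := fun s : ℝ => P (w + s • e) - P w) (K := C * K) (a := 0) (b := 1)
    (hgc.sub continuous_const).continuousOn (fun s _ => (hg s).hasDerivWithinAt) (by simp) ?_ 1 (by simp)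
  · simpa [sub_eq_zero] using hzero
  · intro s hs
    have hs' : s ∈ Set.Icc (0 : ℝ) 1 := Set.Ico_subset_Icc_self hs
    have h0 : P w ∈ (fun s : ℝ => P (w + s • e)) '' Set.Icc 0 1 := ⟨0, by simp, by simp⟩
    have hd := hK.norm_sub_le (Set.mem_image_of_mem _ hs') h0
    rw [he, sub_zero] at hd
    calc ‖fderiv ℝ P (w + s • e) e‖
        = ‖fderiv ℝ P (w + s • e) (Q (P (w + s • e)) e)‖ := by
          conv_lhs => rw [hPQ]
          rfl
      _ ≤ C * (K * ‖P (w + s • e) - P w‖) :=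
          (ContinuousLinearMap.le_opNorm _ _).trans
            (mul_le_mul (hC s hs') hd (norm_nonneg _) ((norm_nonneg _).trans (hC s hs')))
      _ = C * K * ‖P (w + s • e) - P w‖ := by ring

/-- A strictly differentiable idempotent map whose derivative at a point is the identity is the
identity near that point. -/
theorem HasStrictFDerivAt.eventually_eq_self_of_idempotent {E : Type*} [NormedAddCommGroup E]
    [NormedSpace ℝ E] {f : E → E} {x : E} (hf : HasStrictFDerivAt f (ContinuousLinearMap.id ℝ E) x)
    (hfx : f x = x) (hff : ∀ y, f (f y) = f y) : ∀ᶠ y in 𝓝 x, f y = y := by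
  have hlit := hf.isLittleO.def (c := 1 / 2) (by norm_num)
  have ht : Filter.Tendsto (fun y => (f y, y)) (𝓝 x) (𝓝 (x, x)) := by
    have h := hf.continuousAt.prodMk (continuousAt_id (x := x))
    simpa only [ContinuousAt, hfx, id] using h
  filter_upwards [ht.eventually hlit] with y hy
  simp only [hff, sub_self, zero_sub, norm_neg, ContinuousLinearMap.id_apply] at hy
  rw [← sub_eq_zero, ← norm_le_zero_iff]
  linarith [norm_nonneg (f y - y)]

section WeakInverse

variable {n : ℕ} {P u : (Fin n → ℝ) → Fin n → ℝ}

/-- If `P` and `u` are maps with symmetric derivatives (gradients) and `P ∘ u ∘ P = P`, then `P` is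
constant on the line through `u (P w)` and `w`. -/
theorem map_add_smul_eq_of_weak_inverse (hP : ContDiff ℝ ∞ P) (hu : ContDiff ℝ ∞ u)
    (hPu : ∀ w, P (u (P w)) = P w)
    (hPs : ∀ w x y, fderiv ℝ P w x ⬝ᵥ y = x ⬝ᵥ fderiv ℝ P w y)
    (hus : ∀ w x y, fderiv ℝ u w x ⬝ᵥ y = x ⬝ᵥ fderiv ℝ u w y)
    (w : Fin n → ℝ) (s : ℝ) : P (u (P w) + s • (w - u (P w))) = P w := by
  have hPd : Differentiable ℝ P := hP.differentiable (by simp)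
  have hud : Differentiable ℝ u := hu.differentiable (by simp)
  have hleft : ∀ w x, fderiv ℝ P (u (P w)) (fderiv ℝ u (P w) (fderiv ℝ P w x))
      = fderiv ℝ P w x := by
    intro w x
    have h := (hPd (u (P w))).hasFDerivAt.comp w
      ((hud (P w)).hasFDerivAt.comp w (hPd w).hasFDerivAt)
    have h' : HasFDerivAt P _ w := h.congr_of_eventuallyEq
      (Filter.Eventually.of_forall fun y => (hPu y).symm)
    exact (DFunLike.congr_fun ((hPd w).hasFDerivAt.unique h') x).symm
  set Q : (Fin n → ℝ) → (Fin n → ℝ) →L[ℝ] (Fin n → ℝ) :=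
    fun p => (fderiv ℝ u p).comp (fderiv ℝ P (u p)) with hQdef
  have hQ : ContDiff ℝ ∞ Q :=
    (hu.fderiv_right (by simp)).clm_comp ((hP.fderiv_right (m := ∞) (by simp)).comp hu)
  have hright : ∀ w x, fderiv ℝ P w (Q (P w) x) = fderiv ℝ P w x := by
    intro w x
    refine dotProduct_eq _ _ fun y => ?_
    simp only [hQdef, ContinuousLinearMap.comp_apply]
    rw [hPs, hus, hPs, hleft, ← hPs]
  have hQidem : ∀ w x, Q (P w) (Q (P w) x) = Q (P w) x := by
    intro w x
    have h := hright (u (P w)) x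
    rw [hPu] at h
    exact congrArg (fderiv ℝ u (P w)) h
  have hconst : ∀ w e, Q (P w) e = 0 → P (u (P w) + e) = P w := by
    intro w e he
    rw [map_add_eq_of_fderiv_eq_comp hP hQ
      (fun w => ContinuousLinearMap.ext fun x => (hright w x).symm) (by rwa [hPu]), hPu]
  -- the projection onto the fibre of `P` through `u (P w)`
  set Φ : (Fin n → ℝ) → Fin n → ℝ := fun w => w - Q (P w) (w - u (P w)) with hΦdef
  have hΦs : ContDiff ℝ ∞ Φ :=
    contDiff_id.sub ((hQ.comp hP).clm_apply (contDiff_id.sub (hu.comp hP)))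
  have hPΦ : ∀ w, P (Φ w) = P w := by
    intro w
    have h := hconst w ((w - u (P w)) - Q (P w) (w - u (P w))) (by rw [map_sub, hQidem, sub_self])
    rwa [show u (P w) + ((w - u (P w)) - Q (P w) (w - u (P w))) = Φ w by
      simp only [hΦdef]; abel] at h
  have hΦΦ : ∀ w, Φ (Φ w) = Φ w := by
    intro w
    have h : Q (P w) (Φ w - u (P w)) = 0 := by
      rw [show Φ w - u (P w) = (w - u (P w)) - Q (P w) (w - u (P w)) by
        simp only [hΦdef]; abel, map_sub, hQidem, sub_self]
    calc Φ (Φ w) = Φ w - Q (P (Φ w)) (Φ w - u (P (Φ w))) := rfl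
      _ = Φ w := by rw [hPΦ, h, sub_zero]
  have hker : ∀ w, Φ w = w → ∀ ζ, fderiv ℝ P w ζ = 0 → fderiv ℝ P (u (P w)) ζ = 0 := by
    intro w hw ζ hζ
    have he : Q (P w) (w - u (P w)) = 0 := by simpa [hΦdef] using hw
    set Ψ : (Fin n → ℝ) → Fin n → ℝ :=
      fun y => u (P y) + ((w - u (P w)) - Q (P y) (w - u (P w))) with hΨdef
    have hΨd : Differentiable ℝ Ψ := ContDiff.differentiable (n := ∞) ((hu.comp hP).add
      (contDiff_const.sub ((hQ.comp hP).clm_apply contDiff_const))) (by simp)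
    have hPΨ : ∀ y, P (Ψ y) = P y := fun y =>
      hconst y _ (by rw [map_sub, hQidem, sub_self])
    have hΨx : Ψ (u (P w)) = w := by
      simp only [hΨdef, hPu, he, sub_zero, add_sub_cancel]
    have hD : ∀ y, fderiv ℝ P w (fderiv ℝ Ψ (u (P w)) y) = fderiv ℝ P (u (P w)) y := by
      intro y
      have h := (hPd (Ψ (u (P w)))).hasFDerivAt.comp _ (hΨd (u (P w))).hasFDerivAt
      have h' : HasFDerivAt P _ _ := h.congr_of_eventuallyEq
        (Filter.Eventually.of_forall fun y => (hPΨ y).symm)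
      rw [(hPd _).hasFDerivAt.unique h', hΨx]
      rfl
    refine dotProduct_eq_zero _ fun y => ?_
    rw [hPs, ← hD, ← hPs, hζ, zero_dotProduct]
  have hDΦ : ∀ w, Φ w = w → fderiv ℝ Φ w = ContinuousLinearMap.id ℝ _ := by
    intro w hw
    have hΦd : HasFDerivAt Φ (fderiv ℝ Φ w) w := (hΦs.differentiable (by simp) w).hasFDerivAt
    have hinj : ∀ ζ, fderiv ℝ Φ w ζ = 0 → ζ = 0 := by
      intro ζ hζ
      have hPζ : fderiv ℝ P w ζ = 0 := by
        have h := (hPd (Φ w)).hasFDerivAt.comp _ hΦd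
        have h' : HasFDerivAt P _ _ := h.congr_of_eventuallyEq
          (Filter.Eventually.of_forall fun y => (hPΦ y).symm)
        rw [(hPd _).hasFDerivAt.unique h', ContinuousLinearMap.comp_apply, hζ, map_zero]
      have hQζ : Q (P w) ζ = 0 := by
        simp only [hQdef, ContinuousLinearMap.comp_apply, hker w hw ζ hPζ, map_zero]
      have hQd : HasFDerivAt (fun y => Q (P y)) _ w :=
        ((hQ.differentiable (by simp)) (P w)).hasFDerivAt.comp w (hPd w).hasFDerivAt
      have hρd : HasFDerivAt (fun y => y - u (P y)) _ w :=
        (hasFDerivAt_id w).sub ((hud (P w)).hasFDerivAt.comp w (hPd w).hasFDerivAt)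
      have h := (hasFDerivAt_id w).sub (hQd.clm_apply hρd)
      have h2 := DFunLike.congr_fun (hΦd.unique h) ζ
      simpa [hζ, hPζ, hQζ] using h2.symm
    ext1 ζ
    have h : HasFDerivAt (fun y => Φ (Φ y)) ((fderiv ℝ Φ w).comp (fderiv ℝ Φ w)) w := by
      have h := (hw.symm ▸ hΦd : HasFDerivAt Φ (fderiv ℝ Φ w) (Φ w)).comp w hΦd
      exact h
    have h2 := DFunLike.congr_fun ((h.congr_of_eventuallyEq
      (Filter.Eventually.of_forall fun y => (hΦΦ y).symm)).unique hΦd) ζ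
    rw [ContinuousLinearMap.comp_apply] at h2
    have h3 := hinj (fderiv ℝ Φ w ζ - ζ) (by rw [map_sub, h2, sub_self])
    simpa [sub_eq_zero] using h3
  have hopen : IsOpen {w | Φ w = w} := isOpen_iff_mem_nhds.2 fun w hw => by
    have h := hΦs.contDiffAt (x := w) |>.hasStrictFDerivAt (by simp)
    rw [hDΦ w hw] at h
    exact h.eventually_eq_self_of_idempotent hw hΦΦ
  have huniv : {w | Φ w = w} = Set.univ :=
    IsClopen.eq_univ ⟨isClosed_eq hΦs.continuous continuous_id, hopen⟩ ⟨Φ 0, hΦΦ 0⟩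
  have hw : Φ w = w := (Set.eq_univ_iff_forall.1 huniv) w
  refine hconst w _ ?_
  have he : Q (P w) (w - u (P w)) = 0 := by simpa [hΦdef] using hw
  rw [map_smul, he, smul_zero]

end WeakInverse

section Gradient

variable {n : ℕ} {f : (Fin n → ℝ) → ℝ}

theorem fderiv_apply_eq_dotProduct_single (w y : Fin n → ℝ) :
    fderiv ℝ f w y = (fun i => fderiv ℝ f w (Pi.single i 1)) ⬝ᵥ y := by
  conv_lhs => rw [pi_eq_sum_univ' y]
  simp [dotProduct, mul_comm]

theorem contDiff_fderiv_single (hf : ContDiff ℝ ∞ f) :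
    ContDiff ℝ ∞ fun w => fun i => fderiv ℝ f w (Pi.single i 1) :=
  contDiff_pi.2 fun _ => (hf.fderiv_right (by simp)).clm_apply contDiff_const

theorem fderiv_fderiv_single_dotProduct_comm (hf : ContDiff ℝ ∞ f) (w x y : Fin n → ℝ) :
    fderiv ℝ (fun w => fun i => fderiv ℝ f w (Pi.single i 1)) w x ⬝ᵥ y
      = x ⬝ᵥ fderiv ℝ (fun w => fun i => fderiv ℝ f w (Pi.single i 1)) w y := by
  have hd : Differentiable ℝ (fderiv ℝ f) :=
    (hf.fderiv_right (m := ∞) (by simp)).differentiable (by simp)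
  have hG := ((contDiff_fderiv_single hf).differentiable (by simp) w).hasFDerivAt
  have key : ∀ a b : Fin n → ℝ,
      fderiv ℝ (fun w => fun i => fderiv ℝ f w (Pi.single i 1)) w a ⬝ᵥ b
        = fderiv ℝ (fderiv ℝ f) w a b := by
    intro a b
    have h : ∀ i, fderiv ℝ (fun w => fun i => fderiv ℝ f w (Pi.single i 1)) w a i
        = fderiv ℝ (fderiv ℝ f) w a (Pi.single i 1) := by
      intro i
      have h1 := hasFDerivAt_pi'.1 hG i
      have h2 := (hd w).hasFDerivAt.clm_apply (hasFDerivAt_const (Pi.single i (1 : ℝ)) w)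
      simpa using DFunLike.congr_fun (h1.unique h2) a
    conv_rhs => rw [pi_eq_sum_univ' b]
    simp only [dotProduct, h, map_sum, map_smul, smul_eq_mul]
    simp [mul_comm]
  rw [key, dotProduct_comm, key]
  exact (hf.contDiffAt.isSymmSndFDerivAt
    (by
      rw [minSmoothness_of_isRCLikeNormedField]
      exact WithTop.coe_le_coe.2 (le_top : (2 : ℕ∞) ≤ ⊤))).eq x y

/-- If `∇f ∘ ∇h ∘ ∇f = ∇f`, then `f` is affine along the segment from `∇h (∇f w)` to `w`. -/
theorem sub_eq_dotProduct_of_weak_inverse {h : (Fin n → ℝ) → ℝ} (hf : ContDiff ℝ ∞ f)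
    (hh : ContDiff ℝ ∞ h) {P u : (Fin n → ℝ) → Fin n → ℝ}
    (hP : P = fun w i => fderiv ℝ f w (Pi.single i 1))
    (hu : u = fun p i => fderiv ℝ h p (Pi.single i 1))
    (hPu : ∀ w, P (u (P w)) = P w) (w : Fin n → ℝ) :
    f w - f (u (P w)) = P w ⬝ᵥ (w - u (P w)) := by
  have hline := map_add_smul_eq_of_weak_inverse (P := P) (u := u)
    (hP ▸ contDiff_fderiv_single hf) (hu ▸ contDiff_fderiv_single hh) hPu
    (hP ▸ fderiv_fderiv_single_dotProduct_comm hf)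
    (hu ▸ fderiv_fderiv_single_dotProduct_comm hh) w
  set e := w - u (P w) with he
  have hd : ∀ s : ℝ, HasDerivAt (fun s : ℝ => f (u (P w) + s • e) - s * (P w ⬝ᵥ e)) 0 s := by
    intro s
    have h1 : HasDerivAt (fun s : ℝ => u (P w) + s • e) e s := by
      simpa using ((hasDerivAt_id s).smul_const e).const_add (u (P w))
    have h2 := ((hf.differentiable (by simp) _).hasFDerivAt.comp_hasDerivAt s h1).sub
      ((hasDerivAt_id s).mul_const (P w ⬝ᵥ e))
    have h3 : fderiv ℝ f (u (P w) + s • e) e = P w ⬝ᵥ e := by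
      rw [fderiv_apply_eq_dotProduct_single, ← congrFun hP, hline s]
    rw [h3, one_mul, sub_self] at h2
    exact h2
  have hconst := is_const_of_deriv_eq_zero (fun s => (hd s).differentiableAt)
    (fun s => (hd s).deriv) 1 0
  simp only [one_smul, one_mul, zero_smul, zero_mul, add_zero, sub_zero, he] at hconst
  rw [add_sub_cancel] at hconst
  linarith

end Gradient

theorem hasFDerivAt_slice {E₁ E₂ E₃ G : Type*} [NormedAddCommGroup E₁] [NormedSpace ℝ E₁]
    [NormedAddCommGroup E₂] [NormedSpace ℝ E₂] [NormedAddCommGroup E₃] [NormedSpace ℝ E₃]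
    [NormedAddCommGroup G] [NormedSpace ℝ G] {F : E₁ × E₂ × E₃ → G} (hF : Differentiable ℝ F)
    (t : E₁) (q : E₂) (w : E₃) :
    HasFDerivAt (fun w => F (t, q, w)) ((fderiv ℝ F (t, q, w)).comp
      ((ContinuousLinearMap.inr ℝ E₁ (E₂ × E₃)).comp (ContinuousLinearMap.inr ℝ E₂ E₃))) w :=
  (hF (t, q, w)).hasFDerivAt.comp w
    ((hasFDerivAt_prodMk_right t (q, w)).comp w (hasFDerivAt_prodMk_right q w))

theorem fderiv_slice_eq_pV {n : ℕ} {F : ℝ × (Fin n → ℝ) × (Fin n → ℝ) → ℝ}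
    (hF : Differentiable ℝ F) (t : ℝ) (q w : Fin n → ℝ) (i : Fin n) :
    fderiv ℝ (fun w => F (t, q, w)) w (Pi.single i 1) = pV n F i (t, q, w) := by
  rw [(hasFDerivAt_slice hF t q w).fderiv]
  rfl

/-- The derivative of `F` at `(t, q, w)` in the direction `(0, eᵢ, D)`. -/
theorem fderiv_single_prod_eq {n : ℕ} {F : ℝ × (Fin n → ℝ) × (Fin n → ℝ) → ℝ}
    (hF : Differentiable ℝ F) (t : ℝ) (q w D : Fin n → ℝ) (i : Fin n) :
    fderiv ℝ F (t, q, w) (0, Pi.single i 1, D)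
      = pQ n F i (t, q, w) + ∑ j, pV n F j (t, q, w) * D j := by
  have h1 : ((0, Pi.single i 1, D) : ℝ × (Fin n → ℝ) × (Fin n → ℝ))
      = (0, Pi.single i 1, 0) + (0, 0, D) := by simp
  have h2 := fderiv_apply_eq_dotProduct_single (f := fun w => F (t, q, w)) w D
  simp only [fderiv_slice_eq_pV hF] at h2
  rw [(hasFDerivAt_slice hF t q w).fderiv] at h2
  rw [h1, map_add]
  exact congrArg _ h2

/-- On the image of the Legendre map, a weakly associated Hamiltonian is the energy of `L`. -/
theorem hamiltonian_eq_energy {n : ℕ} {L H : ℝ × (Fin n → ℝ) × (Fin n → ℝ) → ℝ}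
    (hL : ContDiff ℝ ∞ L) (hH : ContDiff ℝ ∞ H)
    (hassoc : ∀ (t : ℝ) (q v : Fin n → ℝ),
      (fun i => pV n L i (t, q, fun j => pV n H j (t, q, fun k => pV n L k (t, q, v))))
        = fun i => pV n L i (t, q, v))
    (hweak : ∀ (t : ℝ) (q p : Fin n → ℝ),
      (∃ w : Fin n → ℝ, p = fun i => pV n L i (t, q, w)) →
      H (t, q, p) = (∑ i, p i * pV n H i (t, q, p))
        - L (t, q, fun j => pV n H j (t, q, p)))
    (t : ℝ) (q v : Fin n → ℝ) :
    H (t, q, fun j => pV n L j (t, q, v)) = (∑ i, pV n L i (t, q, v) * v i) - L (t, q, v) := by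
  have hι : ContDiff ℝ ∞ fun w : Fin n → ℝ => (t, q, w) :=
    contDiff_const.prodMk (contDiff_const.prodMk contDiff_id)
  have h := sub_eq_dotProduct_of_weak_inverse (hL.comp hι) (hH.comp hι)
    (P := fun w i => pV n L i (t, q, w)) (u := fun p i => pV n H i (t, q, p))
    (funext₂ fun w i => (fderiv_slice_eq_pV (hL.differentiable (by simp)) t q w i).symm)
    (funext₂ fun w i => (fderiv_slice_eq_pV (hH.differentiable (by simp)) t q w i).symm)
    (hassoc t q) v
  rw [hweak t q _ ⟨v, rfl⟩]
  simp only [dotProduct, Function.comp_apply, Pi.sub_apply, mul_sub, Finset.sum_sub_distrib] at h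
  linarith

/-- If `ℋ` is weakly associated with `L`, `(c,v)` solves the Cartan equations,
and the compatibility condition `Ĥ∘L̂∘(c,v) = (c,c')` holds, then
`r = L̂∘(c,v)`, i.e. `p = ∇_vL(t,c,v)`, solves the Hamilton equations for `ℋ`. -/
theorem cartan_solution_to_hamilton (n : ℕ)
    (L H : ℝ × (Fin n → ℝ) × (Fin n → ℝ) → ℝ)
    (hL : ContDiff ℝ (⊤ : ℕ∞) L) (hH : ContDiff ℝ (⊤ : ℕ∞) H)
    (hassoc : ∀ (t : ℝ) (q v : Fin n → ℝ),
      (fun i => pV n L i (t, q, fun j => pV n H j (t, q, fun k => pV n L k (t, q, v))))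
        = fun i => pV n L i (t, q, v))
    (hweak : ∀ (t : ℝ) (q p : Fin n → ℝ),
      (∃ w : Fin n → ℝ, p = fun i => pV n L i (t, q, w)) →
      H (t, q, p) = (∑ i, p i * pV n H i (t, q, p))
        - L (t, q, fun j => pV n H j (t, q, p)))
    (c v c' π' : ℝ → Fin n → ℝ)
    (hc : ∀ t i, HasDerivAt (fun s => c s i) (c' t i) t)
    (hπ : ∀ t i, HasDerivAt (fun s => pV n L i (s, c s, v s)) (π' t i) t)
    (hcartan1 : ∀ t i,
      (∑ j, fderiv ℝ (fun y => pV n L i y) (t, c t, v t)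
          ((0 : ℝ), (0 : Fin n → ℝ), Pi.single j 1) * (c' t j - v t j)) = 0)
    (hcartan2 : ∀ t i,
      pQ n L i (t, c t, v t) - π' t i
        + (∑ j, (c' t j - v t j) * fderiv ℝ (fun y => pV n L j y) (t, c t, v t)
            ((0 : ℝ), Pi.single i 1, (0 : Fin n → ℝ))) = 0)
    (hcompat : ∀ t : ℝ,
      (fun i => pV n H i (t, c t, fun j => pV n L j (t, c t, v t))) = c' t) :
    ∀ t i,
      c' t i = pV n H i (t, c t, fun j => pV n L j (t, c t, v t)) ∧
      HasDerivAt (fun s => pV n L i (s, c s, v s))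
        (-(pQ n H i (t, c t, fun j => pV n L j (t, c t, v t)))) t := by
  intro t i
  refine ⟨(congrFun (hcompat t) i).symm, ?_⟩
  suffices h : π' t i = -(pQ n H i (t, c t, fun j => pV n L j (t, c t, v t))) from h ▸ hπ t i
  have hLd : Differentiable ℝ L := hL.differentiable (by simp)
  have hHd : Differentiable ℝ H := hH.differentiable (by simp)
  have hPd : ∀ j, Differentiable ℝ fun y => pV n L j y := fun j =>
    ContDiff.differentiable (n := (⊤ : ℕ∞))
      ((hL.fderiv_right (by simp)).clm_apply contDiff_const) (by simp)
  set p : Fin n → ℝ := fun j => pV n L j (t, c t, v t) with hp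
  set D : Fin n → ℝ := fun j => fderiv ℝ (fun y => pV n L j y) (t, c t, v t)
    ((0 : ℝ), Pi.single i 1, (0 : Fin n → ℝ)) with hD
  have hline : HasDerivAt (fun s : ℝ => c t + s • Pi.single i (1 : ℝ)) (Pi.single i 1) 0 := by
    simpa using ((hasDerivAt_id (0 : ℝ)).smul_const (Pi.single i (1 : ℝ))).const_add (c t)
  have hcurve : HasDerivAt (fun s : ℝ => (t, c t + s • Pi.single i (1 : ℝ), v t))
      ((0 : ℝ), Pi.single i 1, (0 : Fin n → ℝ)) 0 :=
    (hasDerivAt_const _ _).prodMk (hline.prodMk (hasDerivAt_const _ _))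
  have hc0 : (t, c t, v t) = (t, c t + (0 : ℝ) • Pi.single i (1 : ℝ), v t) := by simp
  have hpD : ∀ j, HasDerivAt (fun s : ℝ => pV n L j (t, c t + s • Pi.single i (1 : ℝ), v t))
      (D j) 0 := fun j =>
    (hPd j (t, c t, v t)).hasFDerivAt.comp_hasDerivAt_of_eq (0 : ℝ) hcurve hc0
  have hLD : HasDerivAt (fun s : ℝ => L (t, c t + s • Pi.single i (1 : ℝ), v t))
      (pQ n L i (t, c t, v t)) 0 :=
    (hLd (t, c t, v t)).hasFDerivAt.comp_hasDerivAt_of_eq (0 : ℝ) hcurve hc0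
  have hHcurve : HasDerivAt (fun s : ℝ => (t, c t + s • Pi.single i (1 : ℝ),
      fun j => pV n L j (t, c t + s • Pi.single i (1 : ℝ), v t))) (0, Pi.single i 1, D) 0 :=
    (hasDerivAt_const (0 : ℝ) t).prodMk (hline.prodMk (hasDerivAt_pi.2 hpD))
  have hHD : HasDerivAt (fun s : ℝ => H (t, c t + s • Pi.single i (1 : ℝ),
      fun j => pV n L j (t, c t + s • Pi.single i (1 : ℝ), v t)))
      (fderiv ℝ H (t, c t, p) (0, Pi.single i 1, D)) 0 :=
    (hHd (t, c t, p)).hasFDerivAt.comp_hasDerivAt_of_eq (0 : ℝ) hHcurve (by simp [hp])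
  have hED := (HasDerivAt.fun_sum (u := Finset.univ)
    fun j _ => (hpD j).mul_const (v t j)).fun_sub hLD
  simp only [hamiltonian_eq_energy hL hH hassoc hweak] at hHD
  have heq := hHD.unique hED
  rw [fderiv_single_prod_eq hHd] at heq
  have hcomp : ∀ j, pV n H j (t, c t, p) = c' t j := congrFun (hcompat t)
  simp only [hcomp] at heq
  have hcartan := hcartan2 t i
  simp only [sub_mul, Finset.sum_sub_distrib] at hcartan
  have hcomm : ∑ j, D j * v t j = ∑ j, v t j * D j :=
    Finset.sum_congr rfl fun j _ => mul_comm _ _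
  linarith
end

section
/- Let n be a natural number and let L, ℋ : ℝ × (Fin n → ℝ) × (Fin n → ℝ) → ℝ be smooth with ℋ weakly associated with L: (i) for all (t,q,v), ∇_vL(t, q, ∇_pℋ(t, q, ∇_vL(t,q,v))) = ∇_vL(t,q,v); (ii) for every (t,q,p) with p = ∇_vL(t,q,w) for some w, ℋ(t,q,p) = Σᵢ pᵢ ∂ℋ/∂pᵢ(t,q,p) − L(t,q,∇_pℋ(t,q,p)). Fix (t,q,v) and set p = ∇_vL(t,q,v) and v* = ∇_pℋ(t,q,p). Assume (almost regularity/connected fibres) that v and v* are joined by a continuously differentiable path γ : [0,1] → (Fin n → ℝ) with ∇_vL(t,q,γ(s)) = p for all s ∈ [0,1]. Then Σᵢ ∂L/∂vᵢ(t,q,v) · vᵢ − L(t,q,v) = ℋ(t, q, ∇_vL(t,q,v)); i.e. the Poincaré–Cartan form of L is the pull-back of the Hamiltonian form by the Legendre map, and all Hamiltonian forms weakly associated with L coincide on the Lagrangian constraint space. -/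
open scoped BigOperators

/-- The derivative along the third slot is the sum of its partial derivatives. -/
theorem fderiv_third_slot (n : ℕ) (F : ℝ × (Fin n → ℝ) × (Fin n → ℝ) → ℝ)
    (z : ℝ × (Fin n → ℝ) × (Fin n → ℝ)) (w : Fin n → ℝ) :
    fderiv ℝ F z (0, 0, w) = ∑ i, pV n F i z * w i := by
  have h := LinearMap.pi_apply_eq_sum_univ ((fderiv ℝ F z).toLinearMap ∘ₗ
    (LinearMap.inr ℝ ℝ ((Fin n → ℝ) × (Fin n → ℝ)) ∘ₗ
      LinearMap.inr ℝ (Fin n → ℝ) (Fin n → ℝ))) w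
  simp only [LinearMap.comp_apply, LinearMap.inr_apply, ContinuousLinearMap.coe_coe,
    smul_eq_mul] at h
  rw [h]
  refine Finset.sum_congr rfl fun i _ => ?_
  have e : (fun j => if i = j then (1 : ℝ) else 0) = Pi.single i 1 := by
    ext j
    simp [Pi.single_apply, eq_comm]
  rw [e, mul_comm, pV]

/-- The energy `⟨p, v⟩ - F` is constant along a path in the third slot on which the
partial gradient of `F` equals `p`. -/
theorem energy_eq_of_path_in_fibre (n : ℕ) (F : ℝ × (Fin n → ℝ) × (Fin n → ℝ) → ℝ)
    (hF : Differentiable ℝ F) (t : ℝ) (q p : Fin n → ℝ) (γ : ℝ → Fin n → ℝ)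
    (hγ : DifferentiableOn ℝ γ (Set.Icc 0 1))
    (hfib : ∀ s ∈ Set.Icc (0 : ℝ) 1, (fun i => pV n F i (t, q, γ s)) = p) :
    (∑ i, p i * γ 1 i) - F (t, q, γ 1) = (∑ i, p i * γ 0 i) - F (t, q, γ 0) := by
  have key : ∀ s ∈ Set.Icc (0 : ℝ) 1, HasDerivWithinAt
      (fun s => (∑ i, p i * γ s i) - F (t, q, γ s)) 0 (Set.Icc 0 1) s := by
    intro s hs
    have h1 := (hγ s hs).hasDerivWithinAt
    have h2 := (hF (t, q, γ s)).hasFDerivAt.comp_hasDerivWithinAt s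
      ((hasDerivWithinAt_const s (Set.Icc (0 : ℝ) 1) t).prodMk
        ((hasDerivWithinAt_const s (Set.Icc (0 : ℝ) 1) q).prodMk h1))
    have h3 : HasDerivWithinAt (fun s => ∑ i, p i * γ s i)
        (∑ i, p i * derivWithin γ (Set.Icc 0 1) s i) (Set.Icc 0 1) s :=
      HasDerivWithinAt.fun_sum fun i _ => (hasDerivWithinAt_pi.1 h1 i).const_mul (p i)
    have h4 := h3.sub h2
    rw [fderiv_third_slot] at h4
    simp only [fun i => congrFun (hfib s hs) i, sub_self] at h4
    exact h4
  exact constant_of_has_deriv_right_zero (fun s hs => (key s hs).continuousWithinAt)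
    (fun s hs => (key s (Set.Ico_subset_Icc_self hs)).mono_of_mem_nhdsWithin
      (Icc_mem_nhdsGE_of_mem hs)) 1 (by simp)

/-- If `ℋ` is weakly associated with an almost regular `L` and `v` is joined to
`v* = ∇_pℋ(t,q,∇_vL(t,q,v))` by a `C¹` path in the fibre of the Legendre map,
then `Σᵢ ∂L/∂vᵢ·vᵢ − L = ℋ∘L̂` at `(t,q,v)`: the Poincaré–Cartan form is the
pull-back of the Hamiltonian form by the Legendre map. -/
theorem poincare_cartan_pullback (n : ℕ)
    (L H : ℝ × (Fin n → ℝ) × (Fin n → ℝ) → ℝ)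
    (hL : ContDiff ℝ (⊤ : ℕ∞) L) (hH : ContDiff ℝ (⊤ : ℕ∞) H)
    (hassoc : ∀ (t : ℝ) (q v : Fin n → ℝ),
      (fun i => pV n L i (t, q, fun j => pV n H j (t, q, fun k => pV n L k (t, q, v))))
        = fun i => pV n L i (t, q, v))
    (hweak : ∀ (t : ℝ) (q p : Fin n → ℝ),
      (∃ w : Fin n → ℝ, p = fun i => pV n L i (t, q, w)) →
      H (t, q, p) = (∑ i, p i * pV n H i (t, q, p))
        - L (t, q, fun j => pV n H j (t, q, p)))
    (t : ℝ) (q v : Fin n → ℝ)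
    (p vstar : Fin n → ℝ)
    (hp : p = fun i => pV n L i (t, q, v))
    (hvstar : vstar = fun i => pV n H i (t, q, p))
    (γ : ℝ → Fin n → ℝ)
    (hγ : ContDiffOn ℝ 1 γ (Set.Icc 0 1))
    (hγ0 : γ 0 = v) (hγ1 : γ 1 = vstar)
    (hfib : ∀ s ∈ Set.Icc (0 : ℝ) 1, (fun i => pV n L i (t, q, γ s)) = p) :
    (∑ i, pV n L i (t, q, v) * v i) - L (t, q, v)
      = H (t, q, fun i => pV n L i (t, q, v)) := by
  have h := energy_eq_of_path_in_fibre n L (hL.differentiable (by simp)) t q p γ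
    (hγ.differentiableOn (by simp)) hfib
  rw [hγ0, hγ1] at h
  have hw := hweak t q p ⟨v, hp⟩
  rw [← hp, hw, ← hvstar]
  simp only [fun i => (congrFun hp i).symm, fun i => (congrFun hvstar i).symm]
  exact h.symm
end
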